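/- Let D be a strongly connected digraph of girth 4 and |V(D)| ≥ 6 that is not isomorphic to any member of the families H₁–H₇. Then D is λ'-connected and λ(D) ≤ λ'(D) ≤ ξ(D). -/

import Mathlib

/-- A digraph on vertex type `V`, given by its adjacency (arc) relation. -/
structure Digr (V : Type) where
  Adj : V → V → Prop

namespace Digr

variable {V : Type}

/-- Reachability by directed paths. -/
def Reach (D : Digr V) : V → V → Prop := Relation.ReflTransGen D.Adj

/-- A digraph is strongly connected if every vertex reaches every other. -/
def StronglyConnected (D : Digr V) : Prop := ∀ u v : V, D.Reach u v

/-- An oriented graph: no loops and no pair of opposite arcs. -/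
def Oriented (D : Digr V) : Prop := ∀ u v : V, D.Adj u v → ¬ D.Adj v u

/-- The digraph contains at least one arc. -/
def HasArc (D : Digr V) : Prop := ∃ u v : V, D.Adj u v

/-- Delete a set of arcs. -/
def delArcs (D : Digr V) (S : Set (V × V)) : Digr V :=
  ⟨fun a b => D.Adj a b ∧ (a, b) ∉ S⟩

/-- Delete a set of vertices (keep arcs avoiding them). -/
def delVerts (D : Digr V) (X : Set V) : Digr V :=
  ⟨fun a b => D.Adj a b ∧ a ∉ X ∧ b ∉ X⟩

/-- Induced subdigraph on a vertex set. -/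
def induce (D : Digr V) (X : Set V) : Digr V :=
  ⟨fun a b => a ∈ X ∧ b ∈ X ∧ D.Adj a b⟩

/-- The induced subdigraph on `X` is strongly connected. -/
def StronglyConnectedOn (D : Digr V) (X : Set V) : Prop :=
  ∀ u ∈ X, ∀ v ∈ X, (D.induce X).Reach u v

/-- Mutual reachability. -/
def MReach (D : Digr V) (u v : V) : Prop := D.Reach u v ∧ D.Reach v u

/-- `X` is a strong component: an equivalence class of mutual reachability. -/
def IsStrongComponent (D : Digr V) (X : Set V) : Prop :=
  ∃ x : V, X = {y | D.MReach x y}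

/-- `S` is a restricted arc-cut: a set of arcs whose deletion leaves a
non-trivial strong component `X` (containing an arc) such that deleting the
vertices of `X` from `D` leaves an arc. -/
def IsRestrictedArcCut (D : Digr V) (S : Set (V × V)) : Prop :=
  (∀ p ∈ S, D.Adj p.1 p.2) ∧
  ∃ X : Set V, (D.delArcs S).IsStrongComponent X ∧
    (∃ u ∈ X, ∃ v ∈ X, (D.delArcs S).Adj u v) ∧
    (D.delVerts X).HasArc

/-- A digraph is λ'-connected if it admits a restricted arc-cut. -/
def LambdaPrimeConnected (D : Digr V) : Prop :=
  ∃ S : Set (V × V), D.IsRestrictedArcCut S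

/-- λ'(D): minimum size of a restricted arc-cut. -/
noncomputable def lambdaPrime (D : Digr V) [Fintype V] : ℕ :=
  sInf {n : ℕ | ∃ S : Finset (V × V), D.IsRestrictedArcCut ↑S ∧ S.card = n}

/-- λ(D): the arc-connectivity, the minimum size of an arc set whose removal
destroys strong connectivity. -/
noncomputable def lambda (D : Digr V) [Fintype V] : ℕ :=
  sInf {n : ℕ | ∃ S : Finset (V × V), (∀ p ∈ S, D.Adj p.1 p.2) ∧
    ¬ (D.delArcs ↑S).StronglyConnected ∧ S.card = n}

/-- The list `l` of distinct vertices forms a directed cycle. -/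
def IsCycleList (D : Digr V) (l : List V) : Prop :=
  ∃ h : l ≠ [], l.Nodup ∧ l.Chain' D.Adj ∧ D.Adj (l.getLast h) (l.head h)

/-- The girth: minimum length of a directed cycle. -/
noncomputable def girth (D : Digr V) : ℕ :=
  sInf {n : ℕ | ∃ l : List V, D.IsCycleList l ∧ l.length = n}

/-- `(u,v,w,z,u)` is a 4-cycle of `D`. -/
def Cycle4 (D : Digr V) (u v w z : V) : Prop := D.IsCycleList [u, v, w, z]

/-- Out-degree. -/
def outDeg (D : Digr V) [Fintype V] [DecidableRel D.Adj] (v : V) : ℕ :=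
  (Finset.univ.filter fun w => D.Adj v w).card

/-- In-degree. -/
def inDeg (D : Digr V) [Fintype V] [DecidableRel D.Adj] (v : V) : ℕ :=
  (Finset.univ.filter fun w => D.Adj w v).card

/-- ξ(D): minimum over girth cycles `C` of
`min (Σ d⁺ − g, Σ d⁻ − g)`. -/
noncomputable def xi (D : Digr V) [Fintype V] [DecidableRel D.Adj] : ℤ :=
  sInf {k : ℤ | ∃ l : List V, D.IsCycleList l ∧ l.length = D.girth ∧
    k = min (((l.map D.outDeg).sum : ℤ) - (D.girth : ℤ))
            (((l.map D.inDeg).sum : ℤ) - (D.girth : ℤ))}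

/-- ∂⁺(X): the set of arcs from `X` to its complement. -/
noncomputable def outBoundary (D : Digr V) [Fintype V] (X : Set V) : Finset (V × V) :=
  (Set.toFinite {p : V × V | p.1 ∈ X ∧ p.2 ∉ X ∧ D.Adj p.1 p.2}).toFinset

/-- ∂⁻(X): the set of arcs from the complement of `X` into `X`. -/
noncomputable def inBoundary (D : Digr V) [Fintype V] (X : Set V) : Finset (V × V) :=
  (Set.toFinite {p : V × V | p.1 ∉ X ∧ p.2 ∈ X ∧ D.Adj p.1 p.2}).toFinset

/-- The list of arcs of a cycle given as a vertex list. -/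
def cycleArcs (l : List V) : List (V × V) := l.zip (l.rotate 1)

end Digr
namespace Digr

variable {V : Type}

/-- `D` is (isomorphic to) a member of the family H₁. -/
def IsH1 (D : Digr V) : Prop :=
  ∃ (u v w z : V) (A B C E : Set V),
    [u, v, w, z].Nodup ∧
    (∀ t ∈ A ∪ B ∪ C ∪ E, t ∉ ({u, v, w, z} : Set V)) ∧
    List.Pairwise Disjoint [A, B, C, E] ∧
    (∀ t : V, t ∈ ({u, v, w, z} : Set V) ∪ A ∪ B ∪ C ∪ E) ∧
    (∀ p q : V, D.Adj p q ↔
      (p = u ∧ q = v) ∨ (p = v ∧ q = w) ∨ (p = w ∧ q = z) ∨ (p = z ∧ q = u) ∨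
      (p = u ∧ q ∈ A) ∨ (p ∈ A ∧ q = v) ∨
      (p = v ∧ q ∈ B) ∨ (p ∈ B ∧ q = w) ∨
      (p = w ∧ q ∈ C) ∨ (p ∈ C ∧ q = z) ∨
      (p = z ∧ q ∈ E) ∨ (p ∈ E ∧ q = u))

/-- `D` is (isomorphic to) a member of the family H₂. -/
def IsH2 (D : Digr V) : Prop :=
  ∃ (u v w z x : V) (A B : Set V),
    [u, v, w, z, x].Nodup ∧
    (∀ t ∈ A ∪ B, t ∉ ({u, v, w, z, x} : Set V)) ∧
    Disjoint A B ∧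
    (∀ t : V, t ∈ ({u, v, w, z, x} : Set V) ∪ A ∪ B) ∧
    (∀ p q : V, D.Adj p q ↔
      (p = u ∧ q = v) ∨ (p = v ∧ q = w) ∨ (p = w ∧ q = z) ∨ (p = z ∧ q = u) ∨
      (p = w ∧ q = x) ∨ (p = x ∧ q = u) ∨
      (p = w ∧ q ∈ A) ∨ (p ∈ A ∧ q = u) ∨
      (p = u ∧ q ∈ B) ∨ (p ∈ B ∧ q = w))

/-- `D` is (isomorphic to) a member of the family H₃. -/
def IsH3 (D : Digr V) : Prop :=
  ∃ (u v w z x : V) (A B C : Set V),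
    [u, v, w, z, x].Nodup ∧
    (∀ t ∈ A ∪ B ∪ C, t ∉ ({u, v, w, z, x} : Set V)) ∧
    List.Pairwise Disjoint [A, B, C] ∧
    (∀ t : V, t ∈ ({u, v, w, z, x} : Set V) ∪ A ∪ B ∪ C) ∧
    (∀ p q : V, D.Adj p q ↔
      (p = u ∧ q = v) ∨ (p = v ∧ q = w) ∨ (p = w ∧ q = z) ∨ (p = z ∧ q = u) ∨
      (p = w ∧ q = x) ∨ (p = x ∧ q = u) ∨
      (p = u ∧ q ∈ A) ∨ (p ∈ A ∧ q = v) ∨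
      (p = v ∧ q ∈ B) ∨ (p ∈ B ∧ q = w) ∨
      (p = w ∧ q ∈ C) ∨ (p ∈ C ∧ q = u))

/-- `D` is (isomorphic to) a member of the family H₄. -/
def IsH4 (D : Digr V) : Prop :=
  ∃ (u v w z x y : V) (A : Set V),
    [u, v, w, z, x, y].Nodup ∧
    (∀ t ∈ A, t ∉ ({u, v, w, z, x, y} : Set V)) ∧
    (D.Adj y v ∨ D.Adj v y) ∧
    (∀ t : V, t ∈ ({u, v, w, z, x, y} : Set V) ∪ A) ∧
    (∀ p q : V, D.Adj p q ↔
      (p = u ∧ q = v) ∨ (p = v ∧ q = w) ∨ (p = w ∧ q = z) ∨ (p = z ∧ q = u) ∨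
      (p = w ∧ q = x) ∨ (p = x ∧ q = u) ∨
      (p = u ∧ q = y) ∨ (p = y ∧ q = w) ∨
      (p = y ∧ q = v ∧ D.Adj y v) ∨ (p = v ∧ q = y ∧ D.Adj v y) ∨
      (p = w ∧ q ∈ A) ∨ (p ∈ A ∧ q = u))

/-- `D` is (isomorphic to) a member of the family H₅. -/
def IsH5 (D : Digr V) : Prop :=
  ∃ (u v w z x : V) (A : Set V),
    [u, v, w, z, x].Nodup ∧
    (∀ t ∈ A, t ∉ ({u, v, w, z, x} : Set V)) ∧
    (D.Adj x z ∨ D.Adj z x) ∧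
    (∀ t : V, t ∈ ({u, v, w, z, x} : Set V) ∪ A) ∧
    (∀ p q : V, D.Adj p q ↔
      (p = u ∧ q = v) ∨ (p = v ∧ q = w) ∨ (p = w ∧ q = z) ∨ (p = z ∧ q = u) ∨
      (p = w ∧ q = x) ∨ (p = x ∧ q = u) ∨
      (p = x ∧ q = z ∧ D.Adj x z) ∨ (p = z ∧ q = x ∧ D.Adj z x) ∨
      (p = u ∧ q ∈ A) ∨ (p ∈ A ∧ q = w))

/-- `D` is (isomorphic to) a member of the family H₆. -/
def IsH6 (D : Digr V) : Prop :=
  ∃ (u v w z x : V) (A B : Set V),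
    [u, v, w, z, x].Nodup ∧
    (∀ t ∈ A ∪ B, t ∉ ({u, v, w, z, x} : Set V)) ∧
    Disjoint A B ∧
    (D.Adj x z ∨ D.Adj z x) ∧
    (∀ t : V, t ∈ ({u, v, w, z, x} : Set V) ∪ A ∪ B) ∧
    (∀ p q : V, D.Adj p q ↔
      (p = u ∧ q = v) ∨ (p = v ∧ q = w) ∨ (p = w ∧ q = z) ∨ (p = z ∧ q = u) ∨
      (p = w ∧ q = x) ∨ (p = x ∧ q = u) ∨
      (p = x ∧ q = z ∧ D.Adj x z) ∨ (p = z ∧ q = x ∧ D.Adj z x) ∨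
      (p = u ∧ q ∈ A) ∨ (p ∈ A ∧ q = v) ∨
      (p = v ∧ q ∈ B) ∨ (p ∈ B ∧ q = w))

/-- `D` is (isomorphic to) a member of the family H₇. -/
def IsH7 (D : Digr V) : Prop :=
  ∃ u v w z x y : V,
    [u, v, w, z, x, y].Nodup ∧
    (D.Adj x z ∨ D.Adj z x) ∧
    (D.Adj y v ∨ D.Adj v y) ∧
    (∀ t : V, t ∈ ({u, v, w, z, x, y} : Set V)) ∧
    (∀ p q : V, D.Adj p q ↔
      (p = u ∧ q = v) ∨ (p = v ∧ q = w) ∨ (p = w ∧ q = z) ∨ (p = z ∧ q = u) ∨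
      (p = w ∧ q = x) ∨ (p = x ∧ q = u) ∨
      (p = u ∧ q = y) ∨ (p = y ∧ q = w) ∨
      (p = x ∧ q = z ∧ D.Adj x z) ∨ (p = z ∧ q = x ∧ D.Adj z x) ∨
      (p = y ∧ q = v ∧ D.Adj y v) ∨ (p = v ∧ q = y ∧ D.Adj v y))

end Digr

namespace Digr

variable {V : Type}

structure Base (D : Digr V) (u v w z : V) : Prop where
  uv : D.Adj u v
  vw : D.Adj v w
  wz : D.Adj w z
  zu : D.Adj z u
  ori : ∀ a b, D.Adj a b → ¬ D.Adj b a
  tri : ∀ a b c, D.Adj a b → D.Adj b c → ¬ D.Adj c a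
  nuw : u ≠ w
  nvz : v ≠ z
  ind : ∀ p q, D.Adj p q → (p = u ∨ p = v ∨ p = w ∨ p = z) ∨ (q = u ∨ q = v ∨ q = w ∨ q = z)
  hin : ∀ t, ∃ p, D.Adj p t
  hout : ∀ t, ∃ p, D.Adj t p

theorem Base.rot {D : Digr V} {u v w z : V} (h : Base D u v w z) : Base D v w z u where
  uv := h.vw
  vw := h.wz
  wz := h.zu
  zu := h.uv
  ori := h.ori
  tri := h.tri
  nuw := h.nvz
  nvz := h.nuw.symm
  ind := fun p q a => by have := h.ind p q a; tauto
  hin := h.hin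
  hout := h.hout

theorem Base.loop {D : Digr V} {u v w z : V} (h : Base D u v w z) (a : V) : ¬ D.Adj a a :=
  fun x => h.ori a a x x

theorem Base.ne {D : Digr V} {u v w z : V} (h : Base D u v w z) :
    u ≠ v ∧ u ≠ w ∧ u ≠ z ∧ v ≠ w ∧ v ≠ z ∧ w ≠ z := by
  refine ⟨?_, h.nuw, ?_, ?_, h.nvz, ?_⟩
  · rintro rfl; exact h.loop _ h.uv
  · rintro rfl; exact h.loop _ h.zu
  · rintro rfl; exact h.loop _ h.vw
  · rintro rfl; exact h.loop _ h.wz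

/-- no chords -/
theorem Base.chord {D : Digr V} {u v w z : V} (h : Base D u v w z) :
    ¬ D.Adj u w ∧ ¬ D.Adj w u ∧ ¬ D.Adj v z ∧ ¬ D.Adj z v ∧
    ¬ D.Adj v u ∧ ¬ D.Adj w v ∧ ¬ D.Adj z w ∧ ¬ D.Adj u z :=
  ⟨fun a => h.tri _ _ _ a h.wz h.zu, fun a => h.tri _ _ _ a h.uv h.vw,
   fun a => h.tri _ _ _ a h.zu h.uv, fun a => h.tri _ _ _ a h.vw h.wz,
   h.ori _ _ h.uv, h.ori _ _ h.vw, h.ori _ _ h.wz, h.ori _ _ h.zu⟩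

/-- constraints at an outer vertex -/
theorem Base.cls {D : Digr V} {u v w z : V} (h : Base D u v w z) (t : V)
    (ht : t ≠ u ∧ t ≠ v ∧ t ≠ w ∧ t ≠ z) :
    (∀ p, D.Adj p t → p = u ∨ p = v ∨ p = w ∨ p = z) ∧
    (∀ p, D.Adj t p → p = u ∨ p = v ∨ p = w ∨ p = z) ∧
    (D.Adj u t ∨ D.Adj v t ∨ D.Adj w t ∨ D.Adj z t) ∧
    (D.Adj t u ∨ D.Adj t v ∨ D.Adj t w ∨ D.Adj t z) ∧
    (D.Adj u t → ¬ D.Adj t u ∧ ¬ D.Adj t z) ∧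
    (D.Adj v t → ¬ D.Adj t v ∧ ¬ D.Adj t u) ∧
    (D.Adj w t → ¬ D.Adj t w ∧ ¬ D.Adj t v) ∧
    (D.Adj z t → ¬ D.Adj t z ∧ ¬ D.Adj t w) := by
  obtain ⟨t1, t2, t3, t4⟩ := ht
  have hi : ∀ p, D.Adj p t → p = u ∨ p = v ∨ p = w ∨ p = z := by
    intro p hp; have := h.ind _ _ hp; tauto
  have ho : ∀ p, D.Adj t p → p = u ∨ p = v ∨ p = w ∨ p = z := by
    intro p hp; have := h.ind _ _ hp; tauto
  refine ⟨hi, ho, ?_, ?_, ?_, ?_, ?_, ?_⟩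
  · obtain ⟨p, hp⟩ := h.hin t
    rcases hi p hp with rfl | rfl | rfl | rfl <;> tauto
  · obtain ⟨p, hp⟩ := h.hout t
    rcases ho p hp with rfl | rfl | rfl | rfl <;> tauto
  · exact fun a => ⟨h.ori _ _ a, fun b => h.tri _ _ _ a b h.zu⟩
  · exact fun a => ⟨h.ori _ _ a, fun b => h.tri _ _ _ a b h.uv⟩
  · exact fun a => ⟨h.ori _ _ a, fun b => h.tri _ _ _ a b h.vw⟩
  · exact fun a => ⟨h.ori _ _ a, fun b => h.tri _ _ _ a b h.wz⟩

/-- unique in- or out-neighbour -/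
theorem Base.uniq {D : Digr V} {u v w z : V} (h : Base D u v w z) (t : V)
    (ht : t ≠ u ∧ t ≠ v ∧ t ≠ w ∧ t ≠ z) :
    (∃ i, ∀ p, D.Adj p t → p = i) ∨ (∃ o, ∀ p, D.Adj t p → p = o) := by
  obtain ⟨hi, ho, i0, o0, c1, c2, c3, c4⟩ := h.cls t ht
  by_cases k1 : ∃ i, ∀ p, D.Adj p t → p = i
  · exact Or.inl k1
  by_cases k2 : ∃ i, ∀ p, D.Adj t p → p = i
  · exact Or.inr k2
  exfalso
  push Not at k1 k2
  have au : D.Adj v t ∨ D.Adj w t ∨ D.Adj z t := by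
    obtain ⟨p, hp, hn⟩ := k1 u
    rcases hi p hp with rfl | rfl | rfl | rfl <;> first | exact absurd rfl hn | simp only [hp, true_or, or_true]
  have bu : D.Adj t v ∨ D.Adj t w ∨ D.Adj t z := by
    obtain ⟨p, hp, hn⟩ := k2 u
    rcases ho p hp with rfl | rfl | rfl | rfl <;> first | exact absurd rfl hn | simp only [hp, true_or, or_true]
  have av : D.Adj u t ∨ D.Adj w t ∨ D.Adj z t := by
    obtain ⟨p, hp, hn⟩ := k1 v
    rcases hi p hp with rfl | rfl | rfl | rfl <;> first | exact absurd rfl hn | simp only [hp, true_or, or_true]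
  have bv : D.Adj t u ∨ D.Adj t w ∨ D.Adj t z := by
    obtain ⟨p, hp, hn⟩ := k2 v
    rcases ho p hp with rfl | rfl | rfl | rfl <;> first | exact absurd rfl hn | simp only [hp, true_or, or_true]
  have aw : D.Adj u t ∨ D.Adj v t ∨ D.Adj z t := by
    obtain ⟨p, hp, hn⟩ := k1 w
    rcases hi p hp with rfl | rfl | rfl | rfl <;> first | exact absurd rfl hn | simp only [hp, true_or, or_true]
  have bw : D.Adj t u ∨ D.Adj t v ∨ D.Adj t z := by
    obtain ⟨p, hp, hn⟩ := k2 w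
    rcases ho p hp with rfl | rfl | rfl | rfl <;> first | exact absurd rfl hn | simp only [hp, true_or, or_true]
  have az : D.Adj u t ∨ D.Adj v t ∨ D.Adj w t := by
    obtain ⟨p, hp, hn⟩ := k1 z
    rcases hi p hp with rfl | rfl | rfl | rfl <;> first | exact absurd rfl hn | simp only [hp, true_or, or_true]
  have bz : D.Adj t u ∨ D.Adj t v ∨ D.Adj t w := by
    obtain ⟨p, hp, hn⟩ := k2 z
    rcases ho p hp with rfl | rfl | rfl | rfl <;> first | exact absurd rfl hn | simp only [hp, true_or, or_true]
  clear k1 k2 hi ho h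
  grind

theorem dich {p u v w z x : V} (h : ¬ ((p ≠ u ∧ p ≠ v ∧ p ≠ w ∧ p ≠ z) ∧ p ≠ x)) :
    p = z ∨ (p = u ∨ p = v ∨ p = w ∨ p = x) := by tauto

theorem outx {p u v w z x : V} (h : (p ≠ u ∧ p ≠ v ∧ p ≠ w ∧ p ≠ z) ∧ p ≠ x) :
    ¬ (p = u ∨ p = v ∨ p = w ∨ p = x) := by tauto

/-- General cut construction. -/
theorem cut_of_rank (D : Digr V) [Fintype V] (S : Finset (V × V)) (f : V → ℕ) (a b c d : V)
    (hS : ∀ p q, (p, q) ∈ S ↔ D.Adj p q ∧ f q < f p)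
    (hab : D.Adj a b) (hbc : D.Adj b c) (hcd : D.Adj c d) (hda : D.Adj d a)
    (hf : ∀ t, f t = 1 ↔ t = a ∨ t = b ∨ t = c ∨ t = d)
    (harc : ∃ p q, D.Adj p q ∧ f p ≠ 1 ∧ f q ≠ 1) :
    D.IsRestrictedArcCut ↑S := by
  have fa : f a = 1 := (hf a).2 (by simp)
  have fb : f b = 1 := (hf b).2 (by simp)
  have fc : f c = 1 := (hf c).2 (by simp)
  have fd : f d = 1 := (hf d).2 (by simp)
  have key : ∀ p q, D.Adj p q → f p = 1 → f q = 1 → (D.delArcs ↑S).Adj p q := by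
    intro p q h hp hq
    refine ⟨h, ?_⟩
    intro hh
    have := (hS p q).1 (by simpa using hh)
    omega
  have mono : ∀ p q, (D.delArcs ↑S).Reach p q → f p ≤ f q := by
    intro p q h
    induction h with
    | refl => exact le_rfl
    | tail _ h2 ih =>
      refine ih.trans ?_
      by_contra hlt
      exact h2.2 (by simpa using (hS _ _).2 ⟨h2.1, by omega⟩)
  have ab := key _ _ hab fa fb
  have bc := key _ _ hbc fb fc
  have cd := key _ _ hcd fc fd
  have da := key _ _ hda fd fa
  have Rab : (D.delArcs ↑S).Reach a b := Relation.ReflTransGen.single ab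
  have Rbc : (D.delArcs ↑S).Reach b c := Relation.ReflTransGen.single bc
  have Rcd : (D.delArcs ↑S).Reach c d := Relation.ReflTransGen.single cd
  have Rda : (D.delArcs ↑S).Reach d a := Relation.ReflTransGen.single da
  refine ⟨?_, {y | (D.delArcs ↑S).MReach a y}, ⟨a, rfl⟩, ⟨a, ?_, b, ?_, ab⟩, ?_⟩
  · rintro ⟨p, q⟩ h
    exact ((hS p q).1 (by simpa using h)).1
  · exact ⟨Relation.ReflTransGen.refl, Relation.ReflTransGen.refl⟩
  · exact ⟨Rab, Rbc.trans (Rcd.trans Rda)⟩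
  · obtain ⟨p, q, h, hp, hq⟩ := harc
    have no : ∀ y, f y ≠ 1 → y ∉ {y | (D.delArcs ↑S).MReach a y} := by
      rintro y hy ⟨h1, h2⟩
      have := mono _ _ h1
      have := mono _ _ h2
      omega
    exact ⟨p, q, h, no p hp, no q hq⟩

set_option maxHeartbeats 2000000 in
theorem small_cut (D : Digr V) [Fintype V] {u v w z x : V} (h : Base D u v w z)
    (hx : x ≠ u ∧ x ≠ v ∧ x ≠ w ∧ x ≠ z) (wx : D.Adj w x) (xu : D.Adj x u)
    (ht : ∃ t, (t ≠ u ∧ t ≠ v ∧ t ≠ w ∧ t ≠ z) ∧ t ≠ x ∧ (D.Adj t z ∨ D.Adj z t)) :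
    ∃ S : Finset (V × V), D.IsRestrictedArcCut ↑S ∧ S.card + 4 ≤ Fintype.card V := by
  classical
  have hne := h.ne
  have hch := h.chord
  have hxc := h.cls x hx
  -- choose ranks
  have ex : ∀ t, ∃ (k : ℕ) (e : V × V), ((t ≠ u ∧ t ≠ v ∧ t ≠ w ∧ t ≠ z) →
      (k = 0 ∧ ∀ p, D.Adj p t → (p, t) = e) ∨ (k = 2 ∧ ∀ p, D.Adj t p → (t, p) = e)) := by
    intro t
    by_cases h0 : (t ≠ u ∧ t ≠ v ∧ t ≠ w ∧ t ≠ z)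
    · rcases h.uniq t h0 with ⟨i, hi⟩ | ⟨i, hi⟩
      · exact ⟨0, (i, t), fun _ => Or.inl ⟨rfl, fun p hp => by rw [hi p hp]⟩⟩
      · exact ⟨2, (t, i), fun _ => Or.inr ⟨rfl, fun p hp => by rw [hi p hp]⟩⟩
    · exact ⟨0, (t, t), fun h1 => absurd h1 h0⟩
  choose k e hke using ex
  let f : V → ℕ := fun t => if t = u ∨ t = v ∨ t = w ∨ t = x then 1 else
    if t = z then (if D.Adj z x then 0 else 2) else k t
  let g : V → V × V := fun t => if t = z then (if D.Adj z x then (w, z) else (z, u)) else e t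
  let S : Finset (V × V) := Finset.univ.filter fun p => D.Adj p.1 p.2 ∧ f p.2 < f p.1
  have hf : ∀ t, f t = 1 ↔ t = u ∨ t = v ∨ t = w ∨ t = x := by
    intro t
    simp only [f]
    have := hke t
    split_ifs <;> grind
  refine ⟨S, cut_of_rank D S f u v w x ?_ h.uv h.vw wx xu hf ?_, ?_⟩
  · intro p q; simp [S]
  · obtain ⟨t, t1, t2, t3⟩ := ht
    have a1 : f t ≠ 1 := by rw [Ne, hf]; exact outx ⟨t1, t2⟩
    have a2 : f z ≠ 1 := by rw [Ne, hf]; grind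
    rcases t3 with t3 | t3
    · exact ⟨t, z, t3, a1, a2⟩
    · exact ⟨z, t, t3, a2, a1⟩
  · have sub : S ⊆ (Finset.univ \ {u, v, w, x}).image g := by
      rintro ⟨p, q⟩ hpq
      simp only [S, Finset.mem_filter, Finset.mem_univ, true_and] at hpq
      obtain ⟨hA, hlt⟩ := hpq
      simp only [Finset.mem_image, Finset.mem_sdiff, Finset.mem_univ, true_and,
        Finset.mem_insert, Finset.mem_singleton]
      by_cases hq : (q ≠ u ∧ q ≠ v ∧ q ≠ w ∧ q ≠ z) ∧ q ≠ x
      · have hfq : f q = k q := by simp only [f]; grind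
        have hgq : g q = e q := by simp only [g]; grind
        have hfp : f p ≤ 2 := by
          simp only [f]; have := hke p; split_ifs <;> grind
        rcases hke q hq.1 with ⟨k0, h0⟩ | ⟨k0, h0⟩
        · exact ⟨q, outx hq, by rw [hgq, h0 p hA]⟩
        · omega
      by_cases hp : (p ≠ u ∧ p ≠ v ∧ p ≠ w ∧ p ≠ z) ∧ p ≠ x
      · have hfp : f p = k p := by simp only [f]; grind
        have hgp : g p = e p := by simp only [g]; grind
        rcases hke p hp.1 with ⟨k0, h0⟩ | ⟨k0, h0⟩
        · omega
        · exact ⟨p, outx hp, by rw [hgp, h0 q hA]⟩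
      have hz : ¬ (z = u ∨ z = v ∨ z = w ∨ z = x) := by grind
      refine ⟨z, hz, ?_⟩
      have fz : f z = if D.Adj z x then 0 else 2 := by simp only [f]; grind
      have gz : g z = if D.Adj z x then (w, z) else (z, u) := by simp only [g]; grind
      have hp' : p = z ∨ f p = 1 := by rw [hf]; exact dich hp
      have hq' : q = z ∨ f q = 1 := by rw [hf]; exact dich hq
      have hfp := hf p
      have hfq := hf q
      rw [gz]
      have ozx := h.ori z x
      rcases hp' with rfl | hp' <;> rcases hq' with rfl | hq'
      · omega
      · split_ifs at fz ⊢ <;> grind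
      · split_ifs at fz ⊢ <;> grind
      · omega
    have c1 : S.card ≤ (Finset.univ \ {u, v, w, x} : Finset V).card :=
      (Finset.card_le_card sub).trans Finset.card_image_le
    have c2 : ({u, v, w, x} : Finset V).card = 4 := by
      have : x ≠ u ∧ x ≠ v ∧ x ≠ w := ⟨hx.1, hx.2.1, hx.2.2.1⟩
      rw [Finset.card_insert_of_notMem, Finset.card_insert_of_notMem,
        Finset.card_insert_of_notMem, Finset.card_singleton] <;> simp <;> grind
    have c3 := Finset.card_sdiff_add_card_eq_card (Finset.subset_univ ({u, v, w, x} : Finset V))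
    rw [Finset.card_univ] at c3
    omega

end Digr

namespace Digr

variable {V : Type}

/-- outer vertex of the base cycle -/
def Out (u v w z t : V) : Prop := t ≠ u ∧ t ≠ v ∧ t ≠ w ∧ t ≠ z

theorem five (u v w z t : V) : t = u ∨ t = v ∨ t = w ∨ t = z ∨ Out u v w z t := by
  unfold Out; tauto

theorem six (u v w z x t : V) :
    t = u ∨ t = v ∨ t = w ∨ t = z ∨ t = x ∨ (Out u v w z t ∧ t ≠ x) := by
  unfold Out; tauto

theorem seven (u v w z x y t : V) :
    t = u ∨ t = v ∨ t = w ∨ t = z ∨ t = x ∨ t = y ∨ (Out u v w z t ∧ t ≠ x ∧ t ≠ y) := by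
  unfold Out; tauto

theorem isH1_of (D : Digr V) {u v w z : V} (h : Base D u v w z)
    (k1 : ∀ t, Out u v w z t → ¬ (D.Adj w t ∧ D.Adj t u))
    (k2 : ∀ t, Out u v w z t → ¬ (D.Adj z t ∧ D.Adj t v))
    (k3 : ∀ t, Out u v w z t → ¬ (D.Adj u t ∧ D.Adj t w))
    (k4 : ∀ t, Out u v w z t → ¬ (D.Adj v t ∧ D.Adj t z)) : D.IsH1 := by
  have hne := h.ne
  have hch := h.chord
  have hl := h.loop
  have ty : ∀ t, Out u v w z t →
      (D.Adj u t ∧ ¬ D.Adj v t ∧ ¬ D.Adj w t ∧ ¬ D.Adj z t ∧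
        ¬ D.Adj t u ∧ D.Adj t v ∧ ¬ D.Adj t w ∧ ¬ D.Adj t z) ∨
      (¬ D.Adj u t ∧ D.Adj v t ∧ ¬ D.Adj w t ∧ ¬ D.Adj z t ∧
        ¬ D.Adj t u ∧ ¬ D.Adj t v ∧ D.Adj t w ∧ ¬ D.Adj t z) ∨
      (¬ D.Adj u t ∧ ¬ D.Adj v t ∧ D.Adj w t ∧ ¬ D.Adj z t ∧
        ¬ D.Adj t u ∧ ¬ D.Adj t v ∧ ¬ D.Adj t w ∧ D.Adj t z) ∨
      (¬ D.Adj u t ∧ ¬ D.Adj v t ∧ ¬ D.Adj w t ∧ D.Adj z t ∧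
        D.Adj t u ∧ ¬ D.Adj t v ∧ ¬ D.Adj t w ∧ ¬ D.Adj t z) := by
    intro t ht
    obtain ⟨-, -, i0, o0, c1, c2, c3, c4⟩ := h.cls t ht
    have := k1 t ht
    have := k2 t ht
    have := k3 t ht
    have := k4 t ht
    clear k1 k2 k3 k4 hl hne hch h ht
    rcases i0 with a | a | a | a <;> rcases o0 with b | b | b | b <;> grind
  refine ⟨u, v, w, z, {t | Out u v w z t ∧ D.Adj u t}, {t | Out u v w z t ∧ D.Adj v t},
    {t | Out u v w z t ∧ D.Adj w t}, {t | Out u v w z t ∧ D.Adj z t}, ?_, ?_, ?_, ?_, ?_⟩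
  · simp; tauto
  · intro t ht
    simp only [Set.mem_union, Set.mem_ofPred_eq] at ht
    have : Out u v w z t := by tauto
    simpa [Out] using this
  · simp only [List.pairwise_cons, Set.disjoint_left, List.mem_cons, List.not_mem_nil]
    simp only [forall_eq_or_imp, Set.mem_ofPred_eq]
    grind
  · intro t
    simp only [Set.mem_union, Set.mem_ofPred_eq, Set.mem_insert_iff, Set.mem_singleton_iff]
    have := five u v w z t
    have := ty t
    grind
  · intro p q
    have hpq := h.ind p q
    have tp := ty p
    have tq := ty q
    have hlp := hl p
    obtain ⟨h1, h2, h3, h4⟩ : D.Adj u v ∧ D.Adj v w ∧ D.Adj w z ∧ D.Adj z u :=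
      ⟨h.uv, h.vw, h.wz, h.zu⟩
    simp only [Set.mem_ofPred_eq]
    clear ty hl k1 k2 k3 k4 h
    have fp := five u v w z p
    have fq := five u v w z q
    rcases fp with rfl | rfl | rfl | rfl | hp <;>
    rcases fq with rfl | rfl | rfl | rfl | hq <;>
    simp only [Out] at * <;> grind

set_option maxHeartbeats 4000000 in
theorem isH2to7_of (D : Digr V) {u v w z x : V} (h : Base D u v w z)
    (hx : Out u v w z x) (wx : D.Adj w x) (xu : D.Adj x u)
    (k1 : ∀ t s, Out u v w z t → D.Adj w t → D.Adj t u →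
      Out u v w z s → s ≠ t → ¬ D.Adj s z ∧ ¬ D.Adj z s)
    (k2 : ∀ t s, Out u v w z t → D.Adj u t → D.Adj t w →
      Out u v w z s → s ≠ t → ¬ D.Adj s v ∧ ¬ D.Adj v s) :
    D.IsH2 ∨ D.IsH3 ∨ D.IsH4 ∨ D.IsH5 ∨ D.IsH6 ∨ D.IsH7 := by
  have hne := h.ne
  have hch := h.chord
  have hl := h.loop
  have h1 : D.Adj u v := h.uv
  have h2 : D.Adj v w := h.vw
  have h3 : D.Adj w z := h.wz
  have h4 : D.Adj z u := h.zu
  obtain ⟨xu', xv', xw', xz'⟩ := id hx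
  obtain ⟨x1, x2, x3, x4, x5, x6⟩ : ¬ D.Adj u x ∧ ¬ D.Adj v x ∧ ¬ D.Adj x w ∧ ¬ D.Adj x v ∧
      ¬ (D.Adj x z ∧ D.Adj z x) ∧ ¬ D.Adj x x := by
    have := h.cls x hx
    have := hl x
    grind
  -- the other outer vertices
  have ty : ∀ t, Out u v w z t → t ≠ x → (¬ D.Adj t z ∧ ¬ D.Adj z t) ∧
      ((D.Adj u t ∧ ¬ D.Adj v t ∧ ¬ D.Adj w t ∧ ¬ D.Adj t u ∧ D.Adj t v ∧ ¬ D.Adj t w) ∨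
      (¬ D.Adj u t ∧ D.Adj v t ∧ ¬ D.Adj w t ∧ ¬ D.Adj t u ∧ ¬ D.Adj t v ∧ D.Adj t w) ∨
      (¬ D.Adj u t ∧ ¬ D.Adj v t ∧ D.Adj w t ∧ D.Adj t u ∧ ¬ D.Adj t v ∧ ¬ D.Adj t w) ∨
      (D.Adj u t ∧ ¬ (D.Adj v t ∧ D.Adj t v) ∧ ¬ D.Adj w t ∧ ¬ D.Adj t u ∧ D.Adj t w)) := by
    intro t ht htx
    obtain ⟨-, -, i0, o0, c1, c2, c3, c4⟩ := h.cls t ht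
    have := k1 x t hx wx xu ht htx
    clear k1 k2 hl hne hch h ht
    rcases i0 with a | a | a | a <;> rcases o0 with b | b | b | b <;> grind
  -- if x adj z, no other t from w to u
  have tx : (D.Adj x z ∨ D.Adj z x) → ∀ t, Out u v w z t → t ≠ x → ¬ (D.Adj w t ∧ D.Adj t u) := by
    intro hxz t ht htx hh
    have := k1 t x ht hh.1 hh.2 hx (Ne.symm htx)
    exact hxz.elim this.1 this.2
  have k2' : ∀ t s, Out u v w z t → D.Adj u t → D.Adj t w →
      Out u v w z s → s ≠ t → (¬ D.Adj s v ∧ ¬ D.Adj v s) := k2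
  have outer : ∀ p q, Out u v w z p → Out u v w z q → ¬ D.Adj p q := by
    intro p q hp hq hpq
    have := h.ind p q hpq
    simp only [Out] at hp hq
    clear * - hp hq this
    tauto
  by_cases y : ∃ y, Out u v w z y ∧ y ≠ x ∧ D.Adj u y ∧ D.Adj y w ∧ (D.Adj y v ∨ D.Adj v y)
  · obtain ⟨y, hy, yx, uy, yw, hyv⟩ := y
    have ty2 : ∀ t, Out u v w z t → t ≠ x → t ≠ y →
        ¬ D.Adj t z ∧ ¬ D.Adj z t ∧ ¬ D.Adj u t ∧ ¬ D.Adj v t ∧ D.Adj w t ∧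
        D.Adj t u ∧ ¬ D.Adj t v ∧ ¬ D.Adj t w := by
      intro t ht htx hty
      have a1 := ty t ht htx
      have a2 := k2 y t hy uy yw ht hty
      have a3 := k2 t y ht
      grind
    have tyy := ty y hy yx
    have yu' : y ≠ u ∧ y ≠ v ∧ y ≠ w ∧ y ≠ z := hy
    by_cases hxz : D.Adj x z ∨ D.Adj z x
    · -- H7
      have only : ∀ t, Out u v w z t → t = x ∨ t = y := by
        intro t ht
        by_contra hh
        have e1 : t ≠ x := fun e => hh (Or.inl e)
        have a1 := ty2 t ht e1 (fun e => hh (Or.inr e))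
        exact tx hxz t ht e1 ⟨a1.2.2.2.2.1, a1.2.2.2.2.2.1⟩
      right; right; right; right; right
      refine ⟨u, v, w, z, x, y, ?_, hxz, hyv, ?_, ?_⟩
      · simp; grind
      · intro t
        have := five u v w z t
        have := only t
        simp only [Set.mem_insert_iff, Set.mem_singleton_iff]
        grind
      · intro p q
        have hlp := hl p
        have op := outer p q
        have hop := only p
        have hoq := only q
        have fp := five u v w z p
        have fq := five u v w z q
        have oxy := outer x y hx hy
        have oyx := outer y x hy hx
        clear ty ty2 tx k2' outer k1 k2 h only
        have fp' : p = u ∨ p = v ∨ p = w ∨ p = z ∨ p = x ∨ p = y := by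
          clear * - fp hop; tauto
        have fq' : q = u ∨ q = v ∨ q = w ∨ q = z ∨ q = x ∨ q = y := by
          clear * - fq hoq; tauto
        clear fp fq hop hoq op
        rcases fp' with rfl | rfl | rfl | rfl | rfl | rfl <;>
        rcases fq' with rfl | rfl | rfl | rfl | rfl | rfl <;> grind
    · right; right; left
      refine ⟨u, v, w, z, x, y, {t | Out u v w z t ∧ t ≠ x ∧ t ≠ y}, ?_, ?_, hyv, ?_, ?_⟩
      · simp; grind
      · intro t ht
        simp only [Set.mem_ofPred_eq, Out] at ht
        simp only [Set.mem_insert_iff, Set.mem_singleton_iff]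
        clear * - ht
        tauto
      · intro t
        have := five u v w z t
        simp only [Set.mem_insert_iff, Set.mem_singleton_iff, Set.mem_union, Set.mem_ofPred_eq]
        clear * - this
        tauto
      · intro p q
        have tp := ty2 p
        have tq := ty2 q
        have hlp := hl p
        have op := outer p q
        have opx := outer p x
        have oxq := outer x q
        have opy := outer p y
        have oyq := outer y q
        have oxy := outer x y hx hy
        have oyx := outer y x hy hx
        have fp := seven u v w z x y p
        have fq := seven u v w z x y q
        simp only [Set.mem_ofPred_eq]
        clear ty ty2 tx k2' outer k1 k2 h hl
        simp only [Out] at *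
        rcases fp with rfl | rfl | rfl | rfl | rfl | rfl | hp <;>
        rcases fq with rfl | rfl | rfl | rfl | rfl | rfl | hq <;> grind
  · have noy : ∀ t, Out u v w z t → t ≠ x → D.Adj u t → D.Adj t w → ¬ D.Adj t v ∧ ¬ D.Adj v t := by
      intro t ht htx a b
      constructor <;> intro c <;> exact y ⟨t, ht, htx, a, b, by simp [c]⟩
    by_cases hb : ∃ y, Out u v w z y ∧ y ≠ x ∧ D.Adj u y ∧ D.Adj y w
    · obtain ⟨y, hy, yx, uy, yw⟩ := hb
      have nv : ∀ t, Out u v w z t → t ≠ x → ¬ D.Adj t v ∧ ¬ D.Adj v t := by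
        intro t ht htx
        by_cases hty : t = y
        · subst hty; exact noy t ht htx uy yw
        · exact k2 y t hy uy yw ht hty
      by_cases hxz : D.Adj x z ∨ D.Adj z x
      · have ty3 : ∀ t, Out u v w z t → t ≠ x → (¬ D.Adj t z ∧ ¬ D.Adj z t) ∧
          ((D.Adj u t ∧ ¬ D.Adj v t ∧ ¬ D.Adj w t ∧ ¬ D.Adj t u ∧ ¬ D.Adj t v ∧ D.Adj t w)) := by
          intro t ht htx
          have a1 := ty t ht htx
          have a2 := nv t ht htx
          have a3 := tx hxz t ht htx
          clear * - a1 a2 a3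
          grind
        right; right; right; left
        refine ⟨u, v, w, z, x, {t | (Out u v w z t ∧ t ≠ x)}, ?_, ?_, hxz, ?_, ?_⟩
        · simp; grind
        · intro t ht
          simp only [Set.mem_union, Set.mem_ofPred_eq, Out] at ht
          simp only [Set.mem_insert_iff, Set.mem_singleton_iff]
          clear * - ht
          tauto
        · intro t
          have t6 := six u v w z x t
          have t3 := ty3 t
          simp only [Set.mem_insert_iff, Set.mem_singleton_iff, Set.mem_union, Set.mem_ofPred_eq]
          clear * - t6 t3
          grind
        · intro p q
          have tp := ty3 p
          have tq := ty3 q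
          have hlp := hl p
          have op := outer p q
          have opx := outer p x
          have oxq := outer x q
          have fp := six u v w z x p
          have fq := six u v w z x q
          simp only [Set.mem_ofPred_eq]
          clear ty ty3 tx k2' outer k1 k2 h hl noy
          simp only [Out] at *
          rcases fp with rfl | rfl | rfl | rfl | rfl | hp <;>
          rcases fq with rfl | rfl | rfl | rfl | rfl | hq <;> grind
      · have ty3 : ∀ t, Out u v w z t → t ≠ x → (¬ D.Adj t z ∧ ¬ D.Adj z t) ∧
          ((D.Adj u t ∧ ¬ D.Adj v t ∧ ¬ D.Adj w t ∧ ¬ D.Adj t u ∧ ¬ D.Adj t v ∧ D.Adj t w) ∨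
            (¬ D.Adj u t ∧ ¬ D.Adj v t ∧ D.Adj w t ∧ D.Adj t u ∧ ¬ D.Adj t v ∧ ¬ D.Adj t w)) := by
          intro t ht htx
          have a1 := ty t ht htx
          have a2 := nv t ht htx
          have a3 := True.intro
          clear * - a1 a2 a3
          grind
        left
        refine ⟨u, v, w, z, x, {t | (Out u v w z t ∧ t ≠ x) ∧ D.Adj w t}, {t | (Out u v w z t ∧ t ≠ x) ∧ D.Adj u t}, ?_, ?_, ?_, ?_, ?_⟩
        · simp; grind
        · intro t ht
          simp only [Set.mem_union, Set.mem_ofPred_eq, Out] at ht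
          simp only [Set.mem_insert_iff, Set.mem_singleton_iff]
          clear * - ht
          tauto
        · rw [Set.disjoint_left]
          intro t a b
          simp only [Set.mem_ofPred_eq] at a b
          have := ty3 t a.1.1 a.1.2
          clear * - a b this
          grind
        · intro t
          have t6 := six u v w z x t
          have t3 := ty3 t
          simp only [Set.mem_insert_iff, Set.mem_singleton_iff, Set.mem_union, Set.mem_ofPred_eq]
          clear * - t6 t3
          grind
        · intro p q
          have tp := ty3 p
          have tq := ty3 q
          have hlp := hl p
          have op := outer p q
          have opx := outer p x
          have oxq := outer x q
          have fp := six u v w z x p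
          have fq := six u v w z x q
          simp only [Set.mem_ofPred_eq]
          clear ty ty3 tx k2' outer k1 k2 h hl noy
          simp only [Out] at *
          rcases fp with rfl | rfl | rfl | rfl | rfl | hp <;>
          rcases fq with rfl | rfl | rfl | rfl | rfl | hq <;> grind
    · by_cases hxz : D.Adj x z ∨ D.Adj z x
      · have ty3 : ∀ t, Out u v w z t → t ≠ x → (¬ D.Adj t z ∧ ¬ D.Adj z t) ∧
          ((D.Adj u t ∧ ¬ D.Adj v t ∧ ¬ D.Adj w t ∧ ¬ D.Adj t u ∧ D.Adj t v ∧ ¬ D.Adj t w) ∨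
            (¬ D.Adj u t ∧ D.Adj v t ∧ ¬ D.Adj w t ∧ ¬ D.Adj t u ∧ ¬ D.Adj t v ∧ D.Adj t w)) := by
          intro t ht htx
          have a1 := ty t ht htx
          have a2 := fun (e : D.Adj u t ∧ D.Adj t w) => hb ⟨t, ht, htx, e.1, e.2⟩
          have a3 := tx hxz t ht htx
          clear * - a1 a2 a3
          grind
        right; right; right; right; left
        refine ⟨u, v, w, z, x, {t | (Out u v w z t ∧ t ≠ x) ∧ D.Adj u t}, {t | (Out u v w z t ∧ t ≠ x) ∧ D.Adj v t}, ?_, ?_, ?_, hxz, ?_, ?_⟩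
        · simp; grind
        · intro t ht
          simp only [Set.mem_union, Set.mem_ofPred_eq, Out] at ht
          simp only [Set.mem_insert_iff, Set.mem_singleton_iff]
          clear * - ht
          tauto
        · rw [Set.disjoint_left]
          intro t a b
          simp only [Set.mem_ofPred_eq] at a b
          have := ty3 t a.1.1 a.1.2
          clear * - a b this
          grind
        · intro t
          have t6 := six u v w z x t
          have t3 := ty3 t
          simp only [Set.mem_insert_iff, Set.mem_singleton_iff, Set.mem_union, Set.mem_ofPred_eq]
          clear * - t6 t3
          grind
        · intro p q
          have tp := ty3 p
          have tq := ty3 q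
          have hlp := hl p
          have op := outer p q
          have opx := outer p x
          have oxq := outer x q
          have fp := six u v w z x p
          have fq := six u v w z x q
          simp only [Set.mem_ofPred_eq]
          clear ty ty3 tx k2' outer k1 k2 h hl noy
          simp only [Out] at *
          rcases fp with rfl | rfl | rfl | rfl | rfl | hp <;>
          rcases fq with rfl | rfl | rfl | rfl | rfl | hq <;> grind
      · have ty3 : ∀ t, Out u v w z t → t ≠ x → (¬ D.Adj t z ∧ ¬ D.Adj z t) ∧
          ((D.Adj u t ∧ ¬ D.Adj v t ∧ ¬ D.Adj w t ∧ ¬ D.Adj t u ∧ D.Adj t v ∧ ¬ D.Adj t w) ∨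
            (¬ D.Adj u t ∧ D.Adj v t ∧ ¬ D.Adj w t ∧ ¬ D.Adj t u ∧ ¬ D.Adj t v ∧ D.Adj t w) ∨
            (¬ D.Adj u t ∧ ¬ D.Adj v t ∧ D.Adj w t ∧ D.Adj t u ∧ ¬ D.Adj t v ∧ ¬ D.Adj t w)) := by
          intro t ht htx
          have a1 := ty t ht htx
          have a2 := fun (e : D.Adj u t ∧ D.Adj t w) => hb ⟨t, ht, htx, e.1, e.2⟩
          have a3 := True.intro
          clear * - a1 a2 a3
          grind
        right; left
        refine ⟨u, v, w, z, x, {t | (Out u v w z t ∧ t ≠ x) ∧ D.Adj u t}, {t | (Out u v w z t ∧ t ≠ x) ∧ D.Adj v t}, {t | (Out u v w z t ∧ t ≠ x) ∧ D.Adj w t}, ?_, ?_, ?_, ?_, ?_⟩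
        · simp; grind
        · intro t ht
          simp only [Set.mem_union, Set.mem_ofPred_eq, Out] at ht
          simp only [Set.mem_insert_iff, Set.mem_singleton_iff]
          clear * - ht
          tauto
        · simp only [List.pairwise_cons, Set.disjoint_left, List.mem_cons, List.not_mem_nil]
          simp only [forall_eq_or_imp, Set.mem_ofPred_eq]
          clear * - ty3
          grind
        · intro t
          have t6 := six u v w z x t
          have t3 := ty3 t
          simp only [Set.mem_insert_iff, Set.mem_singleton_iff, Set.mem_union, Set.mem_ofPred_eq]
          clear * - t6 t3
          grind
        · intro p q
          have tp := ty3 p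
          have tq := ty3 q
          have hlp := hl p
          have op := outer p q
          have opx := outer p x
          have oxq := outer x q
          have fp := six u v w z x p
          have fq := six u v w z x q
          simp only [Set.mem_ofPred_eq]
          clear ty ty3 tx k2' outer k1 k2 h hl noy
          simp only [Out] at *
          rcases fp with rfl | rfl | rfl | rfl | rfl | hp <;>
          rcases fq with rfl | rfl | rfl | rfl | rfl | hq <;> grind

end Digr

namespace Digr

variable {V : Type}

theorem out_cut (D : Digr V) [Fintype V] [DecidableRel D.Adj] {a b c d : V}
    (hab : D.Adj a b) (hbc : D.Adj b c) (hcd : D.Adj c d) (hda : D.Adj d a)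
    (harc : ∃ p q, D.Adj p q ∧ ¬ (p = a ∨ p = b ∨ p = c ∨ p = d) ∧
      ¬ (q = a ∨ q = b ∨ q = c ∨ q = d)) :
    ∃ S : Finset (V × V), D.IsRestrictedArcCut ↑S ∧
      S.card + 4 ≤ D.outDeg a + D.outDeg b + D.outDeg c + D.outDeg d := by
  classical
  let f : V → ℕ := fun t => if t = a ∨ t = b ∨ t = c ∨ t = d then 1 else 0
  have hf : ∀ t, f t = 1 ↔ t = a ∨ t = b ∨ t = c ∨ t = d := by
    intro t; simp only [f]; split_ifs with h <;> simp [h]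
  let S : Finset (V × V) := Finset.univ.filter fun p => D.Adj p.1 p.2 ∧ f p.2 < f p.1
  let N : V → V → Finset (V × V) := fun s r =>
    ((Finset.univ.filter fun t => D.Adj s t).erase r).image fun t => (s, t)
  have hN : ∀ s r, D.Adj s r → (N s r).card + 1 ≤ D.outDeg s := by
    intro s r h
    have h1 : (N s r).card ≤ ((Finset.univ.filter fun t => D.Adj s t).erase r).card :=
      Finset.card_image_le
    have h2 : ((Finset.univ.filter fun t => D.Adj s t).erase r).card + 1 =
        (Finset.univ.filter fun t => D.Adj s t).card :=
      Finset.card_erase_add_one (by simp [h])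
    simp only [outDeg]
    omega
  refine ⟨S, cut_of_rank D S f a b c d (by intro p q; simp [S]) hab hbc hcd hda hf ?_, ?_⟩
  · obtain ⟨p, q, h, hp, hq⟩ := harc
    exact ⟨p, q, h, by rwa [Ne, hf], by rwa [Ne, hf]⟩
  · have sub : S ⊆ N a b ∪ N b c ∪ N c d ∪ N d a := by
      rintro ⟨p, q⟩ hpq
      simp only [S, f, Finset.mem_filter, Finset.mem_univ, true_and] at hpq
      obtain ⟨hA, hlt⟩ := hpq
      simp only [Finset.mem_union, N, Finset.mem_image, Finset.mem_erase, Finset.mem_filter,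
        Finset.mem_univ, true_and, Prod.mk.injEq]
      grind
    have c0 := Finset.card_le_card sub
    have c1 := Finset.card_union_le (N a b ∪ N b c ∪ N c d) (N d a)
    have c2 := Finset.card_union_le (N a b ∪ N b c) (N c d)
    have c3 := Finset.card_union_le (N a b) (N b c)
    have := hN _ _ hab
    have := hN _ _ hbc
    have := hN _ _ hcd
    have := hN _ _ hda
    omega

theorem in_cut (D : Digr V) [Fintype V] [DecidableRel D.Adj] {a b c d : V}
    (hab : D.Adj a b) (hbc : D.Adj b c) (hcd : D.Adj c d) (hda : D.Adj d a)
    (harc : ∃ p q, D.Adj p q ∧ ¬ (p = a ∨ p = b ∨ p = c ∨ p = d) ∧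
      ¬ (q = a ∨ q = b ∨ q = c ∨ q = d)) :
    ∃ S : Finset (V × V), D.IsRestrictedArcCut ↑S ∧
      S.card + 4 ≤ D.inDeg a + D.inDeg b + D.inDeg c + D.inDeg d := by
  classical
  let f : V → ℕ := fun t => if t = a ∨ t = b ∨ t = c ∨ t = d then 1 else 2
  have hf : ∀ t, f t = 1 ↔ t = a ∨ t = b ∨ t = c ∨ t = d := by
    intro t; simp only [f]; split_ifs with h <;> simp [h]
  let S : Finset (V × V) := Finset.univ.filter fun p => D.Adj p.1 p.2 ∧ f p.2 < f p.1
  let N : V → V → Finset (V × V) := fun r s =>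
    ((Finset.univ.filter fun t => D.Adj t s).erase r).image fun t => (t, s)
  have hN : ∀ r s, D.Adj r s → (N r s).card + 1 ≤ D.inDeg s := by
    intro r s h
    have h1 : (N r s).card ≤ ((Finset.univ.filter fun t => D.Adj t s).erase r).card :=
      Finset.card_image_le
    have h2 : ((Finset.univ.filter fun t => D.Adj t s).erase r).card + 1 =
        (Finset.univ.filter fun t => D.Adj t s).card :=
      Finset.card_erase_add_one (by simp [h])
    simp only [inDeg]
    omega
  refine ⟨S, cut_of_rank D S f a b c d (by intro p q; simp [S]) hab hbc hcd hda hf ?_, ?_⟩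
  · obtain ⟨p, q, h, hp, hq⟩ := harc
    exact ⟨p, q, h, by rwa [Ne, hf], by rwa [Ne, hf]⟩
  · have sub : S ⊆ N a b ∪ N b c ∪ N c d ∪ N d a := by
      rintro ⟨p, q⟩ hpq
      simp only [S, f, Finset.mem_filter, Finset.mem_univ, true_and] at hpq
      obtain ⟨hA, hlt⟩ := hpq
      simp only [Finset.mem_union, N, Finset.mem_image, Finset.mem_erase, Finset.mem_filter,
        Finset.mem_univ, true_and, Prod.mk.injEq]
      grind
    have c0 := Finset.card_le_card sub
    have c1 := Finset.card_union_le (N a b ∪ N b c ∪ N c d) (N d a)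
    have c2 := Finset.card_union_le (N a b ∪ N b c) (N c d)
    have c3 := Finset.card_union_le (N a b) (N b c)
    have := hN _ _ hab
    have := hN _ _ hbc
    have := hN _ _ hcd
    have := hN _ _ hda
    omega

theorem Base.card_out {D : Digr V} [Fintype V] [DecidableRel D.Adj] {a b c d : V}
    (h : Base D a b c d) :
    Fintype.card V ≤ D.outDeg a + D.outDeg b + D.outDeg c + D.outDeg d := by
  classical
  let N : V → Finset V := fun s => Finset.univ.filter fun t => D.Adj s t
  have sub : (Finset.univ : Finset V) ⊆ N a ∪ N b ∪ N c ∪ N d := by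
    intro t _
    simp only [Finset.mem_union, N, Finset.mem_filter, Finset.mem_univ, true_and]
    rcases five a b c d t with rfl | rfl | rfl | rfl | ht
    · simp [h.zu]
    · simp [h.uv]
    · simp [h.vw]
    · simp [h.wz]
    · have := (h.cls t ht).2.2.1
      clear * - this
      tauto
  have c0 := Finset.card_le_card sub
  have c1 := Finset.card_union_le (N a ∪ N b ∪ N c) (N d)
  have c2 := Finset.card_union_le (N a ∪ N b) (N c)
  have c3 := Finset.card_union_le (N a) (N b)
  rw [Finset.card_univ] at c0
  simp only [outDeg]
  simp only [N] at *
  omega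

theorem Base.card_in {D : Digr V} [Fintype V] [DecidableRel D.Adj] {a b c d : V}
    (h : Base D a b c d) :
    Fintype.card V ≤ D.inDeg a + D.inDeg b + D.inDeg c + D.inDeg d := by
  classical
  let N : V → Finset V := fun s => Finset.univ.filter fun t => D.Adj t s
  have sub : (Finset.univ : Finset V) ⊆ N a ∪ N b ∪ N c ∪ N d := by
    intro t _
    simp only [Finset.mem_union, N, Finset.mem_filter, Finset.mem_univ, true_and]
    rcases five a b c d t with rfl | rfl | rfl | rfl | ht
    · simp [h.uv]
    · simp [h.vw]
    · simp [h.wz]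
    · simp [h.zu]
    · have := (h.cls t ht).2.2.2.1
      clear * - this
      tauto
  have c0 := Finset.card_le_card sub
  have c1 := Finset.card_union_le (N a ∪ N b ∪ N c) (N d)
  have c2 := Finset.card_union_le (N a ∪ N b) (N c)
  have c3 := Finset.card_union_le (N a) (N b)
  rw [Finset.card_univ] at c0
  simp only [inDeg]
  simp only [N] at *
  omega

theorem Out.rot {u v w z t : V} (h : Out u v w z t) : Out v w z u t :=
  ⟨h.2.1, h.2.2.1, h.2.2.2, h.1⟩

theorem key_of (D : Digr V) [Fintype V] {u v w z : V} (h : Base D u v w z)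
    (hno : ¬ ∃ S : Finset (V × V), D.IsRestrictedArcCut ↑S ∧ S.card + 4 ≤ Fintype.card V) :
    ∀ t s, Out u v w z t → D.Adj w t → D.Adj t u →
      Out u v w z s → s ≠ t → ¬ D.Adj s z ∧ ¬ D.Adj z s := by
  intro t s ht wt tu hs hst
  constructor
  · intro hh; exact hno (small_cut D h ht wt tu ⟨s, hs, hst, Or.inl hh⟩)
  · intro hh; exact hno (small_cut D h ht wt tu ⟨s, hs, hst, Or.inr hh⟩)

theorem fam_of (D : Digr V) [Fintype V] {u v w z x : V} (h : Base D u v w z)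
    (hno : ¬ ∃ S : Finset (V × V), D.IsRestrictedArcCut ↑S ∧ S.card + 4 ≤ Fintype.card V)
    (hx : Out u v w z x) (wx : D.Adj w x) (xu : D.Adj x u) :
    D.IsH2 ∨ D.IsH3 ∨ D.IsH4 ∨ D.IsH5 ∨ D.IsH6 ∨ D.IsH7 :=
  isH2to7_of D h hx wx xu (key_of D h hno)
    (fun t s ht a b hs => key_of D h.rot.rot hno t s ht.rot.rot a b hs.rot.rot)

theorem base_cut (D : Digr V) [Fintype V] {u v w z : V} (h : Base D u v w z)
    (h1 : ¬ Digr.IsH1 D) (h2 : ¬ Digr.IsH2 D) (h3 : ¬ Digr.IsH3 D)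
    (h4 : ¬ Digr.IsH4 D) (h5 : ¬ Digr.IsH5 D) (h6 : ¬ Digr.IsH6 D)
    (h7 : ¬ Digr.IsH7 D) :
    ∃ S : Finset (V × V), D.IsRestrictedArcCut ↑S ∧ S.card + 4 ≤ Fintype.card V := by
  by_contra hno
  have hh : ¬ (D.IsH2 ∨ D.IsH3 ∨ D.IsH4 ∨ D.IsH5 ∨ D.IsH6 ∨ D.IsH7) := by
    rintro (k | k | k | k | k | k) <;> contradiction
  exact h1 (isH1_of D h (fun t ht e => hh (fam_of D h hno ht e.1 e.2))
    (fun t ht e => hh (fam_of D h.rot hno ht.rot e.1 e.2))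
    (fun t ht e => hh (fam_of D h.rot.rot hno ht.rot.rot e.1 e.2))
    (fun t ht e => hh (fam_of D h.rot.rot.rot hno ht.rot.rot.rot e.1 e.2)))

end Digr

/-- main theorem: a strong digraph of girth 4 on at least 6
vertices, not a member of H₁–H₇, is λ'-connected with
`λ(D) ≤ λ'(D) ≤ ξ(D)`. -/
theorem stmt19 {V : Type} [Fintype V] (D : Digr V) [DecidableRel D.Adj]
    (hO : D.Oriented) (hS : D.StronglyConnected) (hg : D.girth = 4)
    (hcard : 6 ≤ Fintype.card V)
    (h1 : ¬ Digr.IsH1 D) (h2 : ¬ Digr.IsH2 D) (h3 : ¬ Digr.IsH3 D)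
    (h4 : ¬ Digr.IsH4 D) (h5 : ¬ Digr.IsH5 D) (h6 : ¬ Digr.IsH6 D)
    (h7 : ¬ Digr.IsH7 D) :
    D.LambdaPrimeConnected ∧ D.lambda ≤ D.lambdaPrime ∧
      (D.lambdaPrime : ℤ) ≤ D.xi := by
  classical
  have hcyc : ∀ l : List V, D.IsCycleList l → 4 ≤ l.length := by
    intro l hl
    rw [← hg]
    exact Nat.sInf_le ⟨l, hl, rfl⟩
  have tri : ∀ a b c, D.Adj a b → D.Adj b c → ¬ D.Adj c a := by
    intro a b c hab hbc hca
    have n1 : a ≠ b := by rintro rfl; exact hO _ _ hab hab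
    have n2 : b ≠ c := by rintro rfl; exact hO _ _ hbc hbc
    have n3 : a ≠ c := by rintro rfl; exact hO _ _ hca hca
    have := hcyc [a, b, c] ⟨by simp, by simp [n1, n2, n3], by unfold List.Chain'; simp [hab, hbc], by simpa using hca⟩
    simp at this
  have hnt : Nontrivial V := Fintype.one_lt_card_iff_nontrivial.1 (by omega)
  have hin : ∀ t, ∃ p, D.Adj p t := by
    intro t
    obtain ⟨s, hs⟩ := exists_ne t
    rcases Relation.ReflTransGen.cases_tail (hS s t) with h | ⟨c, _, h⟩
    · exact absurd h.symm hs
    · exact ⟨c, h⟩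
  have hout : ∀ t, ∃ p, D.Adj t p := by
    intro t
    obtain ⟨s, hs⟩ := exists_ne t
    rcases Relation.ReflTransGen.cases_head (hS t s) with h | ⟨c, h, _⟩
    · exact absurd h.symm hs
    · exact ⟨c, h⟩
  -- cuts for every 4-cycle
  have main : ∀ l : List V, D.IsCycleList l → l.length = 4 →
      (∃ S : Finset (V × V), D.IsRestrictedArcCut ↑S ∧ S.card + 4 ≤ (l.map D.outDeg).sum) ∧
      (∃ S : Finset (V × V), D.IsRestrictedArcCut ↑S ∧ S.card + 4 ≤ (l.map D.inDeg).sum) := by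
    intro l hl h4l
    obtain ⟨a, b, c, d, rfl⟩ := List.length_eq_four.1 h4l
    obtain ⟨_, hnd, hch, hda⟩ := hl
    unfold List.Chain' at hch
    simp at hnd hch hda
    obtain ⟨hab, hbc, hcd⟩ := hch
    have e1 : (([a, b, c, d].map D.outDeg).sum) =
      D.outDeg a + D.outDeg b + D.outDeg c + D.outDeg d := by simp; ring
    have e2 : (([a, b, c, d].map D.inDeg).sum) =
      D.inDeg a + D.inDeg b + D.inDeg c + D.inDeg d := by simp; ring
    rw [e1, e2]
    by_cases harc : ∃ p q, D.Adj p q ∧ ¬ (p = a ∨ p = b ∨ p = c ∨ p = d) ∧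
      ¬ (q = a ∨ q = b ∨ q = c ∨ q = d)
    · exact ⟨D.out_cut hab hbc hcd hda harc, D.in_cut hab hbc hcd hda harc⟩
    · have hB : Digr.Base D a b c d :=
        { uv := hab, vw := hbc, wz := hcd, zu := hda, ori := hO, tri := tri
          nuw := hnd.1.2.1
          nvz := hnd.2.1.2
          ind := by
            intro p q hpq
            by_contra hcon
            rw [not_or] at hcon
            exact harc ⟨p, q, hpq, hcon.1, hcon.2⟩
          hin := hin, hout := hout }
      obtain ⟨S, hS1, hS2⟩ := Digr.base_cut D hB h1 h2 h3 h4 h5 h6 h7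
      exact ⟨⟨S, hS1, hS2.trans hB.card_out⟩, ⟨S, hS1, hS2.trans hB.card_in⟩⟩
  obtain ⟨l0, hl0, hl04⟩ : ∃ l : List V, D.IsCycleList l ∧ l.length = 4 := by
    have hne : {n : ℕ | ∃ l : List V, D.IsCycleList l ∧ l.length = n}.Nonempty := by
      apply Nat.nonempty_of_pos_sInf
      change 0 < D.girth
      omega
    have := Nat.sInf_mem hne
    change ∃ l : List V, D.IsCycleList l ∧ l.length = D.girth at this
    rwa [hg] at this
  obtain ⟨S0, hS0, -⟩ := (main l0 hl0 hl04).1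
  refine ⟨⟨_, hS0⟩, ?_, ?_⟩
  · have hmem : D.lambdaPrime ∈
        {n : ℕ | ∃ S : Finset (V × V), D.IsRestrictedArcCut ↑S ∧ S.card = n} :=
      Nat.sInf_mem ⟨S0.card, S0, hS0, rfl⟩
    obtain ⟨S, hSr, hSc⟩ := hmem
    refine Nat.sInf_le ⟨S, fun p hp => hSr.1 p (by simpa using hp), ?_, hSc⟩
    intro hstr
    obtain ⟨-, X, ⟨x, rfl⟩, -, p, q, -, hp, -⟩ := hSr
    exact hp ⟨hstr x p, hstr p x⟩
  · refine le_csInf ⟨_, l0, hl0, by rw [hg, hl04], rfl⟩ ?_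
    rintro k ⟨l, hl, hlg, rfl⟩
    rw [hg] at hlg
    obtain ⟨⟨S1, r1, c1⟩, ⟨S2, r2, c2⟩⟩ := main l hl hlg
    have b1 : D.lambdaPrime ≤ S1.card := Nat.sInf_le ⟨S1, r1, rfl⟩
    have b2 : D.lambdaPrime ≤ S2.card := Nat.sInf_le ⟨S2, r2, rfl⟩
    rw [hg]
    refine le_min ?_ ?_
    · omega
    · omega
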